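/- There is an absolute constant C > 0 such that the following holds. Let G be a Label-Cover instance (with R = dL and d-regular projection fibers) satisfying c₀-smoothness for a constant c₀ ∈ (0, 1/3), let ε ∈ (0, 1/2], s ∈ (0, 1), and set γ := s^{(c₀+1)/4} ε^{1/c₀}. Then for every family of functions {f_v : {−1,1}^{2R} → {−1,1}}_{v∈V}: | E_{u,v,w} E_{𝒯₂}[ Π_{j=1}^k f_v(x_j) f_w(y_j) ] − E_{u,v,w} E_{𝒯₂}[ Π_{j=1}^k (T_{1−γ} f_v)(x_j) (T_{1−γ} f_w)(y_j) ] | ≤ C · k · s^{c₀/8}. -/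

import Mathlib

open Finset

/-! Common setup for the long code test `𝒯₂` of Dinur–Kol / this paper.

A Label-Cover instance consists of a bipartite graph on `U × V` given by a Boolean
adjacency relation `Adj`, with projections `π u v : Fin R → Fin L`; we assume `R = d·L`
and that all fibers `π_{uv}^{-1}(i)` have size `d`.  Long-code strings in `{0,1}^{2R}`
are indexed by `Fin R ⊕ Fin R` (`Sum.inl j` is position `j ∈ [R]`, `Sum.inr j` is
position `j + R`). -/

/-- Choose `P1` if `b = true`, else `P0`. -/
def pick {k : ℕ} (P0 P1 : (Fin k → Bool) → ℝ) (b : Bool) : (Fin k → Bool) → ℝ :=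
  if b = true then P1 else P0

/-- The fiber `π_{uv}^{-1}(i) ⊆ [R]`. -/
def fib {U V : Type} {L R : ℕ} (π : U → V → Fin R → Fin L) (u : U) (v : V) (i : Fin L) :
    Finset (Fin R) :=
  univ.filter (fun j => π u v j = i)

/-- Mass contributed by block `i ∈ [L]` of the test `𝒯₂` for fixed `u, v, w`:
a uniform bit `c₁` decides whether the `X`-columns of the block (of both halves,
`B_{uv}(i)` and `B'_{uv}(i)`) are i.i.d. `𝒫₀` and the `Y`-columns i.i.d. `𝒫₁`, or vice
versa; then independently with probability `1 − 2ε` nothing is changed, with probability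
`ε` the primed halves `(X|_{B'_{uv}(i)}, Y|_{B'_{uw}(i)})` are resampled uniformly, and
with probability `ε` the unprimed halves are resampled uniformly. -/
noncomputable def blockM {U V : Type} {k L R : ℕ} (π : U → V → Fin R → Fin L)
    (ε : ℝ) (P0 P1 : (Fin k → Bool) → ℝ) (d : ℕ) (u : U) (v w : V) (i : Fin L)
    (X Y : Fin k → (Fin R ⊕ Fin R) → Bool) : ℝ :=
  (1 / 2) * ∑ b : Bool,
    ((1 - 2 * ε) *
        ((∏ j ∈ fib π u v i,
            pick P0 P1 b (fun r => X r (Sum.inl j)) * pick P0 P1 b (fun r => X r (Sum.inr j))) *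
         (∏ j ∈ fib π u w i,
            pick P0 P1 (!b) (fun r => Y r (Sum.inl j)) * pick P0 P1 (!b) (fun r => Y r (Sum.inr j))))
     + ε * ((∏ j ∈ fib π u v i, pick P0 P1 b (fun r => X r (Sum.inl j))) *
            (∏ j ∈ fib π u w i, pick P0 P1 (!b) (fun r => Y r (Sum.inl j)))) *
          ((1 : ℝ) / 2 ^ k) ^ (2 * d)
     + ε * ((∏ j ∈ fib π u v i, pick P0 P1 b (fun r => X r (Sum.inr j))) *
            (∏ j ∈ fib π u w i, pick P0 P1 (!b) (fun r => Y r (Sum.inr j)))) *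
          ((1 : ℝ) / 2 ^ k) ^ (2 * d))

/-- Mass of the pair of matrices `(X, Y)` under the test `𝒯₂` for fixed `u, v, w`:
the blocks `i ∈ [L]` are independent. -/
noncomputable def massT2 {U V : Type} {k L R : ℕ} (π : U → V → Fin R → Fin L)
    (ε : ℝ) (P0 P1 : (Fin k → Bool) → ℝ) (d : ℕ) (u : U) (v w : V)
    (X Y : Fin k → (Fin R ⊕ Fin R) → Bool) : ℝ :=
  ∏ i : Fin L, blockM π ε P0 P1 d u v w i X Y

/-- Expectation over `(X, Y) ∼ 𝒯₂` (for fixed `u, v, w`) of a function of the two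
matrices. -/
noncomputable def ET2 {U V : Type} {k L R : ℕ} (π : U → V → Fin R → Fin L)
    (ε : ℝ) (P0 P1 : (Fin k → Bool) → ℝ) (d : ℕ) (u : U) (v w : V)
    (h : (Fin k → (Fin R ⊕ Fin R) → Bool) → (Fin k → (Fin R ⊕ Fin R) → Bool) → ℝ) : ℝ :=
  ∑ X : Fin k → (Fin R ⊕ Fin R) → Bool, ∑ Y : Fin k → (Fin R ⊕ Fin R) → Bool,
    massT2 π ε P0 P1 d u v w X Y * h X Y

/-- The neighbors of `u ∈ U` in the bipartite graph. -/
def nbr {U V : Type} [Fintype V] (Adj : U → V → Bool) (u : U) : Finset V :=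
  univ.filter (fun v => Adj u v = true)

/-- Expectation over a uniform `u ∈ U` and uniform independent neighbors `v, w` of `u`. -/
noncomputable def Euvw {U V : Type} [Fintype U] [Fintype V] (Adj : U → V → Bool)
    (h : U → V → V → ℝ) : ℝ :=
  (1 / (Fintype.card U : ℝ)) * ∑ u : U, (1 / ((nbr Adj u).card : ℝ) ^ 2) *
    ∑ v ∈ nbr Adj u, ∑ w ∈ nbr Adj u, h u v w

/-- The Fourier character `χ_β` on `{0,1}^{2R}` (bits identified with `±1`). -/
def chi {R : ℕ} (β : Finset (Fin R ⊕ Fin R)) (x : (Fin R ⊕ Fin R) → Bool) : ℝ :=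
  ∏ c ∈ β, (if x c = true then (-1 : ℝ) else 1)

/-- The Fourier coefficient `f̂(β)` of `f : {0,1}^{2R} → ℝ` over the uniform
distribution. -/
noncomputable def fhat {R : ℕ} (f : ((Fin R ⊕ Fin R) → Bool) → ℝ)
    (β : Finset (Fin R ⊕ Fin R)) : ℝ :=
  (∑ x : (Fin R ⊕ Fin R) → Bool, f x * chi β x) / (2 : ℝ) ^ (2 * R)

/-- The noise operator `T_{1-γ} f = Σ_β (1-γ)^{|β|} f̂(β) χ_β`. -/
noncomputable def noiseT {R : ℕ} (γ : ℝ) (f : ((Fin R ⊕ Fin R) → Bool) → ℝ) :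
    ((Fin R ⊕ Fin R) → Bool) → ℝ :=
  fun x => ∑ β : Finset (Fin R ⊕ Fin R), (1 - γ) ^ β.card * fhat f β * chi β x

/-- `π̃_{uv}(β) := {i ∈ [L] : ∃ j ∈ [R], (j ∈ β ∨ j + R ∈ β) ∧ π_{uv}(j) = i}`. -/
def ptil {U V : Type} {L R : ℕ} (π : U → V → Fin R → Fin L) (u : U) (v : V)
    (β : Finset (Fin R ⊕ Fin R)) : Finset (Fin L) :=
  univ.filter (fun i => ∃ j : Fin R, (Sum.inl j ∈ β ∨ Sum.inr j ∈ β) ∧ π u v j = i)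

/-- The grouped influence `Inf̄ᵘ_i[f] = Σ_{α : i ∈ π̃_{uv}(α)} f̂(α)²`. -/
noncomputable def gInf {U V : Type} {L R : ℕ} (π : U → V → Fin R → Fin L) (u : U) (v : V)
    (f : ((Fin R ⊕ Fin R) → Bool) → ℝ) (i : Fin L) : ℝ :=
  ∑ β ∈ univ.filter (fun β : Finset (Fin R ⊕ Fin R) => i ∈ ptil π u v β), (fhat f β) ^ 2

/-- The sign `(-1)^b` of a bit. -/
def bitSign (b : Bool) : ℝ := if b = true then -1 else 1

lemma bitSign_not (b : Bool) : bitSign (!b) = -bitSign b := by cases b <;> simp [bitSign]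

lemma bitSign_mul_self (b : Bool) : bitSign b * bitSign b = 1 := by cases b <;> simp [bitSign]

lemma chi_eq_prod_bitSign {R : ℕ} (β : Finset (Fin R ⊕ Fin R)) (x : (Fin R ⊕ Fin R) → Bool) :
    chi β x = ∏ c ∈ β, bitSign (x c) := rfl

lemma chi_mul_self {R : ℕ} (β : Finset (Fin R ⊕ Fin R)) (x : (Fin R ⊕ Fin R) → Bool) :
    chi β x * chi β x = 1 := by
  rw [chi_eq_prod_bitSign, ← prod_mul_distrib]
  simp [bitSign_mul_self]

/-- Flip the bit of `x` at position `c`. -/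
def flipAt {α : Type*} [DecidableEq α] (c : α) (x : α → Bool) : α → Bool :=
  Function.update x c (!x c)

lemma flipAt_involutive {α : Type*} [DecidableEq α] (c : α) :
    Function.Involutive (flipAt c : (α → Bool) → α → Bool) := by
  intro x
  simp [flipAt]

lemma chi_flipAt_of_mem {R : ℕ} {β : Finset (Fin R ⊕ Fin R)} {c : Fin R ⊕ Fin R} (hc : c ∈ β)
    (x : (Fin R ⊕ Fin R) → Bool) : chi β (flipAt c x) = -chi β x := by
  rw [chi_eq_prod_bitSign, chi_eq_prod_bitSign, ← mul_prod_erase _ _ hc, ← mul_prod_erase _ _ hc,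
    ← neg_mul]
  congr 1
  · simp [flipAt, bitSign_not]
  · refine prod_congr rfl fun c' hc' => ?_
    rw [flipAt, Function.update_of_ne (ne_of_mem_erase hc')]

lemma chi_flipAt_of_notMem {R : ℕ} {β : Finset (Fin R ⊕ Fin R)} {c : Fin R ⊕ Fin R} (hc : c ∉ β)
    (x : (Fin R ⊕ Fin R) → Bool) : chi β (flipAt c x) = chi β x := by
  rw [chi_eq_prod_bitSign, chi_eq_prod_bitSign]
  refine prod_congr rfl fun c' hc' => ?_
  rw [flipAt, Function.update_of_ne (ne_of_mem_of_not_mem hc' hc)]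

lemma sum_eq_zero_of_involutive_neg {α : Type*} [Fintype α] {e : α → α}
    (he : Function.Involutive e) {F : α → ℝ} (hF : ∀ x, F (e x) = -F x) : ∑ x, F x = 0 := by
  have h := Equiv.sum_comp he.toPerm F
  simp only [Function.Involutive.coe_toPerm, hF, sum_neg_distrib] at h
  linarith

lemma card_bitStrings (R : ℕ) :
    (Fintype.card ((Fin R ⊕ Fin R) → Bool) : ℝ) = 2 ^ (2 * R) := by
  simp [two_mul]

lemma sum_chi_mul_chi {R : ℕ} (α β : Finset (Fin R ⊕ Fin R)) :
    ∑ x, chi α x * chi β x = if α = β then (2 : ℝ) ^ (2 * R) else 0 := by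
  split_ifs with h
  · subst h
    simp only [chi_mul_self, sum_const, card_univ, nsmul_eq_mul, mul_one, card_bitStrings]
  · obtain ⟨c, hc⟩ : ∃ c, ¬ (c ∈ α ↔ c ∈ β) := by
      by_contra! hcon
      exact h (Finset.ext hcon)
    refine sum_eq_zero_of_involutive_neg (flipAt_involutive c) fun x => ?_
    by_cases h1 : c ∈ α <;> by_cases h2 : c ∈ β
    · tauto
    · rw [chi_flipAt_of_mem h1, chi_flipAt_of_notMem h2, neg_mul]
    · rw [chi_flipAt_of_notMem h1, chi_flipAt_of_mem h2, mul_neg]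
    · tauto

lemma sum_sq_fourier {R : ℕ} (s : Finset (Finset (Fin R ⊕ Fin R)))
    (a : Finset (Fin R ⊕ Fin R) → ℝ) :
    ∑ x, (∑ β ∈ s, a β * chi β x) ^ 2 = 2 ^ (2 * R) * ∑ β ∈ s, a β ^ 2 := by
  have h : ∀ x : (Fin R ⊕ Fin R) → Bool, (∑ β ∈ s, a β * chi β x) ^ 2
      = ∑ α ∈ s, ∑ β ∈ s, a α * a β * (chi α x * chi β x) := by
    intro x
    rw [sq, sum_mul_sum]
    exact sum_congr rfl fun _ _ => sum_congr rfl fun _ _ => by ring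
  simp only [h]
  rw [sum_comm, mul_sum]
  refine sum_congr rfl fun α hα => ?_
  rw [sum_comm]
  simp only [← mul_sum, sum_chi_mul_chi, mul_ite, mul_zero]
  rw [sum_ite_eq s α, if_pos hα]
  ring

lemma noiseT_eq_sum_kernel {R : ℕ} (γ : ℝ) (f : ((Fin R ⊕ Fin R) → Bool) → ℝ)
    (x : (Fin R ⊕ Fin R) → Bool) :
    noiseT γ f x = (∑ y, f y * ∏ c, (1 + (1 - γ) * (bitSign (x c) * bitSign (y c))))
      / 2 ^ (2 * R) := by
  simp only [noiseT, fhat, prod_one_add, mul_sum, sum_mul, sum_div, powerset_univ]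
  rw [sum_comm]
  refine sum_congr rfl fun y _ => sum_congr rfl fun β _ => ?_
  rw [prod_mul_distrib, prod_mul_distrib, prod_const, chi_eq_prod_bitSign, chi_eq_prod_bitSign]
  ring

lemma noiseT_zero {R : ℕ} (f : ((Fin R ⊕ Fin R) → Bool) → ℝ) : noiseT 0 f = f := by
  funext x
  rw [noiseT_eq_sum_kernel, sum_eq_single x]
  · have h : ∀ c, (1 : ℝ) + (1 - 0) * (bitSign (x c) * bitSign (x c)) = 2 := by
      intro c
      rw [bitSign_mul_self]
      norm_num
    simp only [h, prod_const, card_univ, Fintype.card_sum, Fintype.card_fin, ← two_mul]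
    field_simp
  · intro y _ hy
    obtain ⟨c, hc⟩ := Function.ne_iff.mp hy
    rw [prod_eq_zero (mem_univ c), mul_zero]
    cases h1 : y c <;> cases h2 : x c <;> simp_all [bitSign]
  · simp

lemma abs_noiseT_le_one {R : ℕ} {γ : ℝ} (h0 : 0 ≤ γ) (h1 : γ ≤ 1)
    {f : ((Fin R ⊕ Fin R) → Bool) → ℝ} (hf : ∀ x, |f x| ≤ 1) (x : (Fin R ⊕ Fin R) → Bool) :
    |noiseT γ f x| ≤ 1 := by
  have hK : ∀ y : (Fin R ⊕ Fin R) → Bool,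
      0 ≤ ∏ c, (1 + (1 - γ) * (bitSign (x c) * bitSign (y c))) := by
    intro y
    refine prod_nonneg fun c _ => ?_
    cases y c <;> cases x c <;> simp [bitSign] <;> linarith
  have hsum : ∑ y : (Fin R ⊕ Fin R) → Bool,
      ∏ c, (1 + (1 - γ) * (bitSign (x c) * bitSign (y c))) = 2 ^ (2 * R) := by
    rw [← Fintype.prod_sum fun c b => 1 + (1 - γ) * (bitSign (x c) * bitSign b)]
    have h : ∀ c, ∑ b, (1 + (1 - γ) * (bitSign (x c) * bitSign b)) = 2 := by
      intro c
      simp [bitSign]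
      ring
    simp only [h, prod_const, card_univ, Fintype.card_sum, Fintype.card_fin, ← two_mul]
  rw [noiseT_eq_sum_kernel, abs_div, abs_of_pos (by positivity : (0 : ℝ) < 2 ^ (2 * R)),
    div_le_one (by positivity), ← hsum]
  refine (abs_sum_le_sum_abs _ _).trans (sum_le_sum fun y _ => ?_)
  rw [abs_mul, abs_of_nonneg (hK y)]
  exact mul_le_of_le_one_left (hK y) (hf y)

lemma sum_fhat_sq {R : ℕ} {f : ((Fin R ⊕ Fin R) → Bool) → ℝ} (hf : ∀ x, f x = 1 ∨ f x = -1) :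
    ∑ β, fhat f β ^ 2 = 1 := by
  have h := sum_sq_fourier univ (fhat f)
  have h2 : ∀ x, ∑ β, fhat f β * chi β x = f x := by
    intro x
    conv_rhs => rw [← noiseT_zero f]
    simp [noiseT]
  have h3 : ∀ x, f x ^ 2 = 1 := fun x => by rcases hf x with h | h <;> simp [h]
  simp only [h2, h3, sum_const, card_univ, nsmul_eq_mul, mul_one, card_bitStrings] at h
  have : (0 : ℝ) < 2 ^ (2 * R) := by positivity
  exact (mul_left_cancel₀ this.ne' (by linarith)).symm

lemma noiseT_sub_self {R : ℕ} (γ : ℝ) (f : ((Fin R ⊕ Fin R) → Bool) → ℝ)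
    (x : (Fin R ⊕ Fin R) → Bool) :
    noiseT γ f x - f x = ∑ β, (((1 - γ) ^ #β - 1) * fhat f β) * chi β x := by
  conv_lhs => rw [← congrFun (noiseT_zero f) x]
  simp only [noiseT, ← sum_sub_distrib]
  refine sum_congr rfl fun β _ => ?_
  simp
  ring

/-- If every column of `X` is drawn independently and has an unbiased `j`-th entry, then the
`j`-th row of `X` is uniform. -/
lemma sum_prod_columns_mul_row {k R : ℕ} {W : Fin R ⊕ Fin R → (Fin k → Bool) → ℝ} {j : Fin k}
    (hW : ∀ c b, ∑ x ∈ univ.filter (fun x : Fin k → Bool => x j = b), W c x = 1 / 2)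
    (φ : ((Fin R ⊕ Fin R) → Bool) → ℝ) :
    ∑ X : Fin k → (Fin R ⊕ Fin R) → Bool, (∏ c, W c (fun r => X r c)) * φ (X j)
      = (∑ z, φ z) / 2 ^ (2 * R) := by
  rw [← Equiv.sum_comp (Equiv.piComm fun (_ : Fin R ⊕ Fin R) (_ : Fin k) => Bool)]
  rw [← sum_fiberwise univ (fun Z : (Fin R ⊕ Fin R) → Fin k → Bool => fun c => Z c j), sum_div]
  refine sum_congr rfl fun z _ => ?_
  have hset : univ.filter (fun Z : (Fin R ⊕ Fin R) → Fin k → Bool => (fun c => Z c j) = z)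
      = Fintype.piFinset fun c => univ.filter (fun x : Fin k → Bool => x j = z c) := by
    ext Z
    simp [funext_iff]
  calc _ = ∑ Z ∈ univ.filter (fun Z : (Fin R ⊕ Fin R) → Fin k → Bool => (fun c => Z c j) = z),
        (∏ c, W c (Z c)) * φ z := by
        refine sum_congr rfl fun Z hZ => ?_
        rw [← (mem_filter.mp hZ).2]
        rfl
    _ = _ := by
        rw [← sum_mul, hset, ← prod_univ_sum]
        simp only [hW, prod_const, card_univ, Fintype.card_sum, Fintype.card_fin, ← two_mul]
        rw [one_div, inv_pow]
        ring

lemma abs_le_half_add_sq_div {l : ℝ} (hl : 0 < l) (x : ℝ) : |x| ≤ (l + x ^ 2 / l) / 2 := by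
  have h : (l + x ^ 2 / l) / 2 - |x| = (l - |x|) ^ 2 / (2 * l) := by
    field_simp
    rw [← sq_abs x]
    ring
  have : 0 ≤ (l - |x|) ^ 2 / (2 * l) := by positivity
  linarith

lemma abs_sum_columns_le {k R : ℕ} {W : Fin R ⊕ Fin R → (Fin k → Bool) → ℝ} {j : Fin k}
    (hW0 : ∀ c x, 0 ≤ W c x)
    (hW : ∀ c b, ∑ x ∈ univ.filter (fun x : Fin k → Bool => x j = b), W c x = 1 / 2)
    {S : Finset (Fin R ⊕ Fin R)} (hS : ∀ c ∈ S, ∀ x, W c x = 1 / 2 ^ k)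
    {H : (Fin k → (Fin R ⊕ Fin R) → Bool) → ℝ} (hH : ∀ X, |H X| ≤ 1)
    (hHj : ∀ X z, H (Function.update X j z) = H X)
    (a : Finset (Fin R ⊕ Fin R) → ℝ) {l : ℝ} (hl : 0 < l) :
    |∑ X : Fin k → (Fin R ⊕ Fin R) → Bool, (∏ c, W c (fun r => X r c)) *
        ((∑ β, a β * chi β (X j)) * H X)|
      ≤ (l + (∑ β ∈ univ.filter (fun β => Disjoint β S), a β ^ 2) / l) / 2 := by
  have hzero : ∀ β, ¬ Disjoint β S → ∑ X : Fin k → (Fin R ⊕ Fin R) → Bool,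
      (∏ c, W c (fun r => X r c)) * (chi β (X j) * H X) = 0 := by
    intro β hβ
    obtain ⟨c, hcβ, hcS⟩ := not_disjoint_iff.mp hβ
    refine sum_eq_zero_of_involutive_neg
      (e := fun X => Function.update X j (flipAt c (X j))) (fun X => ?_) fun X => ?_
    · simp [flipAt_involutive c (X j)]
    · rw [hHj, Function.update_self, chi_flipAt_of_mem hcβ, neg_mul, mul_neg]
      congr 2
      refine prod_congr rfl fun c' _ => ?_
      by_cases hc : c' = c
      · subst hc
        rw [hS _ hcS, hS _ hcS]
      · congr 1
        funext r
        by_cases hr : r = j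
        · subst hr
          simp [flipAt, hc]
        · simp [hr]
  have hrestrict : ∑ X : Fin k → (Fin R ⊕ Fin R) → Bool, (∏ c, W c (fun r => X r c)) *
        ((∑ β, a β * chi β (X j)) * H X)
      = ∑ X : Fin k → (Fin R ⊕ Fin R) → Bool, (∏ c, W c (fun r => X r c)) *
        ((∑ β ∈ univ.filter (fun β => Disjoint β S), a β * chi β (X j)) * H X) := by
    simp only [sum_mul, mul_sum]
    rw [sum_comm, sum_comm (s := univ) (t := univ.filter _)]
    refine (sum_subset (filter_subset _ _) fun β _ hβ => ?_).symm
    have h := hzero β (by simpa using hβ)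
    calc _ = a β * ∑ X : Fin k → (Fin R ⊕ Fin R) → Bool,
          (∏ c, W c (fun r => X r c)) * (chi β (X j) * H X) := by
          rw [mul_sum]
          exact sum_congr rfl fun _ _ => by ring
      _ = 0 := by rw [h, mul_zero]
  rw [hrestrict]
  set φ : ((Fin R ⊕ Fin R) → Bool) → ℝ :=
    fun z => ∑ β ∈ univ.filter (fun β => Disjoint β S), a β * chi β z with hφ
  have hsq := sum_sq_fourier (univ.filter (fun β => Disjoint β S)) a
  calc _ ≤ ∑ X : Fin k → (Fin R ⊕ Fin R) → Bool, (∏ c, W c (fun r => X r c)) *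
        ((l + φ (X j) ^ 2 / l) / 2) := by
        refine (abs_sum_le_sum_abs _ _).trans (sum_le_sum fun X _ => ?_)
        have hnn : 0 ≤ ∏ c, W c (fun r => X r c) := prod_nonneg fun c _ => hW0 c _
        rw [abs_mul, abs_of_nonneg hnn, abs_mul]
        refine mul_le_mul_of_nonneg_left ?_ hnn
        exact (mul_le_of_le_one_right (abs_nonneg _) (hH X)).trans (abs_le_half_add_sq_div hl _)
    _ = (∑ z, (l + φ z ^ 2 / l) / 2) / 2 ^ (2 * R) :=
        sum_prod_columns_mul_row hW fun z => (l + φ z ^ 2 / l) / 2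
    _ = _ := by
        rw [← sum_div, sum_add_distrib, ← sum_div, hsq, sum_const, card_univ, nsmul_eq_mul,
          card_bitStrings]
        field_simp

/-- The weight of the outcome `(b, o)` in one block: `b` is the bit `c₁`, and `o` tells which half
is resampled (`some true` for the unprimed half, `some false` for the primed half). -/
noncomputable def outcomeWeight (ε : ℝ) (t : Bool × Option Bool) : ℝ :=
  1 / 2 * if t.2 = none then 1 - 2 * ε else ε

/-- The distribution of a column in the half `h` of a block where the bit is `b` and the half `o`
is resampled. -/
noncomputable def columnDist {k : ℕ} (P0 P1 : (Fin k → Bool) → ℝ) (b : Bool) (o : Option Bool)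
    (h : Bool) (x : Fin k → Bool) : ℝ :=
  if o = some h then 1 / 2 ^ k else pick P0 P1 b x

/-- The block of `[L]` containing the position `c ∈ [2R]`. -/
def blockOf {U V : Type} {L R : ℕ} (π : U → V → Fin R → Fin L) (u : U) (v : V)
    (c : Fin R ⊕ Fin R) : Fin L :=
  π u v (Sum.elim id id c)

lemma outcomeWeight_nonneg {ε : ℝ} (h0 : 0 ≤ ε) (h1 : ε ≤ 1 / 2) (t : Bool × Option Bool) :
    0 ≤ outcomeWeight ε t := by
  unfold outcomeWeight
  split_ifs <;> linarith

lemma sum_outcomeWeight (ε : ℝ) : ∑ t, outcomeWeight ε t = 1 := by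
  simp [outcomeWeight, Fintype.sum_prod_type]

lemma columnDist_nonneg {k : ℕ} {P0 P1 : (Fin k → Bool) → ℝ} (h0 : ∀ x, 0 ≤ P0 x)
    (h1 : ∀ x, 0 ≤ P1 x) (b : Bool) (o : Option Bool) (h : Bool) (x : Fin k → Bool) :
    0 ≤ columnDist P0 P1 b o h x := by
  unfold columnDist pick
  split_ifs
  · positivity
  · exact h1 x
  · exact h0 x

lemma sum_uniform_filter {k : ℕ} (j : Fin k) (b : Bool) :
    ∑ _x ∈ univ.filter (fun x : Fin k → Bool => x j = b), (1 : ℝ) / 2 ^ k = 1 / 2 := by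
  have hall : ∑ _x : Fin k → Bool, (1 : ℝ) / 2 ^ k = 1 := by simp
  have hflip : ∑ _x ∈ univ.filter (fun x : Fin k → Bool => ¬ x j = b), (1 : ℝ) / 2 ^ k
      = ∑ _x ∈ univ.filter (fun x : Fin k → Bool => x j = b), (1 : ℝ) / 2 ^ k := by
    refine sum_nbij' (flipAt j) (flipAt j) ?_ ?_ ?_ ?_ ?_
    · intro x hx
      cases hxj : x j <;> cases b <;> simp_all [flipAt]
    · intro x hx
      cases hxj : x j <;> cases b <;> simp_all [flipAt]
    · exact fun x _ => flipAt_involutive j x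
    · exact fun x _ => flipAt_involutive j x
    · exact fun _ _ => rfl
  have := sum_filter_add_sum_filter_not univ (fun x : Fin k → Bool => x j = b)
    (fun _ => (1 : ℝ) / 2 ^ k)
  rw [hflip, hall] at this
  linarith

lemma sum_filter_columnDist {k : ℕ} {P0 P1 : (Fin k → Bool) → ℝ} {j : Fin k}
    (h0 : ∀ b : Bool, ∑ x ∈ univ.filter (fun x : Fin k → Bool => x j = b), P0 x = 1 / 2)
    (h1 : ∀ b : Bool, ∑ x ∈ univ.filter (fun x : Fin k → Bool => x j = b), P1 x = 1 / 2)
    (b : Bool) (o : Option Bool) (h b' : Bool) :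
    ∑ x ∈ univ.filter (fun x : Fin k → Bool => x j = b'), columnDist P0 P1 b o h x = 1 / 2 := by
  unfold columnDist pick
  split_ifs
  · exact sum_uniform_filter j b'
  · exact h1 b'
  · exact h0 b'

lemma prod_fib {U V : Type} {L R : ℕ} (π : U → V → Fin R → Fin L) (u : U) (v : V)
    (F : Fin L → Fin R → ℝ) : ∏ i, ∏ j ∈ fib π u v i, F i j = ∏ j, F (π u v j) j := by
  rw [← prod_fiberwise univ (π u v)]
  refine prod_congr rfl fun i _ => prod_congr rfl fun j hj => ?_
  rw [(mem_filter.mp hj).2]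

lemma blockM_eq_sum {U V : Type} {k L R : ℕ} (π : U → V → Fin R → Fin L)
    (ε : ℝ) (P0 P1 : (Fin k → Bool) → ℝ) {d : ℕ} (u : U) (v w : V) (i : Fin L)
    (hd : ∀ v, #(fib π u v i) = d) (X Y : Fin k → (Fin R ⊕ Fin R) → Bool) :
    blockM π ε P0 P1 d u v w i X Y = ∑ t : Bool × Option Bool, outcomeWeight ε t *
      ((∏ j ∈ fib π u v i, columnDist P0 P1 t.1 t.2 true (fun r => X r (Sum.inl j)) *
          columnDist P0 P1 t.1 t.2 false (fun r => X r (Sum.inr j))) *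
       (∏ j ∈ fib π u w i, columnDist P0 P1 (!t.1) t.2 true (fun r => Y r (Sum.inl j)) *
          columnDist P0 P1 (!t.1) t.2 false (fun r => Y r (Sum.inr j)))) := by
  rw [Fintype.sum_prod_type, blockM, mul_sum]
  refine sum_congr rfl fun b _ => ?_
  simp only [Fintype.sum_option, Fintype.sum_bool, outcomeWeight, columnDist, prod_mul_distrib]
  simp [two_mul, pow_add, hd]
  ring

lemma massT2_eq_sum {U V : Type} {k L R : ℕ} (π : U → V → Fin R → Fin L)
    (ε : ℝ) (P0 P1 : (Fin k → Bool) → ℝ) {d : ℕ} (u : U) (v w : V)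
    (hd : ∀ v i, #(fib π u v i) = d) (X Y : Fin k → (Fin R ⊕ Fin R) → Bool) :
    massT2 π ε P0 P1 d u v w X Y = ∑ τ : Fin L → Bool × Option Bool,
      (∏ i, outcomeWeight ε (τ i)) *
      ((∏ c, columnDist P0 P1 (τ (blockOf π u v c)).1 (τ (blockOf π u v c)).2 c.isLeft
          (fun r => X r c)) *
       (∏ c, columnDist P0 P1 (!(τ (blockOf π u w c)).1) (τ (blockOf π u w c)).2 c.isLeft
          (fun r => Y r c))) := by
  simp only [massT2, blockM_eq_sum π ε P0 P1 u v w _ fun v => hd v _]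
  rw [Fintype.prod_sum]
  refine sum_congr rfl fun τ _ => ?_
  rw [prod_mul_distrib, prod_mul_distrib,
    prod_fib π u v fun i j => columnDist P0 P1 (τ i).1 (τ i).2 true (fun r => X r (Sum.inl j)) *
          columnDist P0 P1 (τ i).1 (τ i).2 false (fun r => X r (Sum.inr j)),
    prod_fib π u w fun i j => columnDist P0 P1 (!(τ i).1) (τ i).2 true (fun r => Y r (Sum.inl j)) *
          columnDist P0 P1 (!(τ i).1) (τ i).2 false (fun r => Y r (Sum.inr j))]
  simp [Fintype.prod_sum_type, prod_mul_distrib, blockOf]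

/-- The positions of `[2R]` whose columns are resampled when the outcome in block `i` is `τ i`. -/
def resampled {U V : Type} {L R : ℕ} (π : U → V → Fin R → Fin L) (u : U) (v : V)
    (τ : Fin L → Bool × Option Bool) : Finset (Fin R ⊕ Fin R) :=
  univ.filter fun c => (τ (blockOf π u v c)).2 = some c.isLeft

lemma mem_ptil {U V : Type} {L R : ℕ} {π : U → V → Fin R → Fin L} {u : U} {v : V}
    {β : Finset (Fin R ⊕ Fin R)} {i : Fin L} :
    i ∈ ptil π u v β ↔ ∃ c ∈ β, blockOf π u v c = i := by
  simp [ptil, blockOf, or_and_right, exists_or]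

lemma sum_outcomeWeight_disjoint_le {U V : Type} {L R : ℕ} (π : U → V → Fin R → Fin L)
    {ε : ℝ} (h0 : 0 ≤ ε) (h1 : ε ≤ 1 / 2) (u : U) (v : V) (β : Finset (Fin R ⊕ Fin R)) :
    ∑ τ : Fin L → Bool × Option Bool, (∏ i, outcomeWeight ε (τ i)) *
        (if Disjoint β (resampled π u v τ) then 1 else 0) ≤ (1 - ε) ^ #(ptil π u v β) := by
  have hind : ∀ τ : Fin L → Bool × Option Bool, (∏ i, outcomeWeight ε (τ i)) *
        (if Disjoint β (resampled π u v τ) then (1 : ℝ) else 0)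
      = ∏ i, (if ∀ c ∈ β, blockOf π u v c = i → (τ i).2 ≠ some c.isLeft
          then outcomeWeight ε (τ i) else 0) := by
    intro τ
    rw [Fintype.prod_ite_zero, mul_ite, mul_one, mul_zero]
    congr 1
    simp only [disjoint_left, resampled, mem_filter, mem_univ, true_and, eq_iff_iff]
    constructor
    · rintro h i c hc rfl
      exact h hc
    · exact fun h c hc => h _ c hc rfl
  simp only [hind]
  rw [← Fintype.prod_sum fun i (t : Bool × Option Bool) =>
      if ∀ c ∈ β, blockOf π u v c = i → t.2 ≠ some c.isLeft then outcomeWeight ε t else 0]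
  have hpow : (1 - ε) ^ #(ptil π u v β) = ∏ i, if i ∈ ptil π u v β then 1 - ε else 1 := by
    rw [prod_ite_mem, univ_inter, prod_const]
  rw [hpow]
  refine prod_le_prod (fun i _ => sum_nonneg fun t _ => ?_) fun i _ => ?_
  · split_ifs
    exacts [outcomeWeight_nonneg h0 h1 t, le_rfl]
  split_ifs with hi
  · obtain ⟨c, hc, hci⟩ := mem_ptil.mp hi
    calc _ ≤ ∑ t : Bool × Option Bool, if t.2 ≠ some c.isLeft then outcomeWeight ε t else 0 := by
          refine sum_le_sum fun t _ => ?_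
          by_cases ht : t.2 = some c.isLeft
          · rw [if_neg fun h => h c hc hci ht, if_neg (not_not.mpr ht)]
          · rw [if_pos ht]
            split_ifs
            exacts [le_rfl, outcomeWeight_nonneg h0 h1 t]
      _ ≤ 1 - ε := by
          rw [Fintype.sum_prod_type]
          cases c.isLeft <;> simp [outcomeWeight] <;> linarith
  · rw [← sum_outcomeWeight ε]
    refine sum_le_sum fun t _ => ?_
    split_ifs
    exacts [le_rfl, outcomeWeight_nonneg h0 h1 t]

lemma ET2_eq_sum {U V : Type} {k L R : ℕ} (π : U → V → Fin R → Fin L)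
    (ε : ℝ) (P0 P1 : (Fin k → Bool) → ℝ) {d : ℕ} (u : U) (v w : V)
    (hd : ∀ v i, #(fib π u v i) = d)
    (h : (Fin k → (Fin R ⊕ Fin R) → Bool) → (Fin k → (Fin R ⊕ Fin R) → Bool) → ℝ) :
    ET2 π ε P0 P1 d u v w h = ∑ τ : Fin L → Bool × Option Bool,
      (∏ i, outcomeWeight ε (τ i)) *
      ∑ Y : Fin k → (Fin R ⊕ Fin R) → Bool,
       (∏ c, columnDist P0 P1 (!(τ (blockOf π u w c)).1) (τ (blockOf π u w c)).2 c.isLeft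
          (fun r => Y r c)) *
       ∑ X : Fin k → (Fin R ⊕ Fin R) → Bool,
       (∏ c, columnDist P0 P1 (τ (blockOf π u v c)).1 (τ (blockOf π u v c)).2 c.isLeft
          (fun r => X r c)) * h X Y := by
  simp only [ET2, massT2_eq_sum π ε P0 P1 u v w hd, sum_mul, mul_sum]
  rw [sum_comm]
  conv_lhs => enter [2, Y]; rw [sum_comm]
  rw [sum_comm]
  refine sum_congr rfl fun τ _ => sum_congr rfl fun Y _ => sum_congr rfl fun X _ => ?_
  ring

lemma abs_ET2_le {U V : Type} {k L R : ℕ} (π : U → V → Fin R → Fin L)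
    {ε : ℝ} (hε0 : 0 ≤ ε) (hε1 : ε ≤ 1 / 2) {P0 P1 : (Fin k → Bool) → ℝ}
    (hP0 : ∀ x, 0 ≤ P0 x) (hP1 : ∀ x, 0 ≤ P1 x) {j : Fin k}
    (hm0 : ∀ b : Bool, ∑ x ∈ univ.filter (fun x : Fin k → Bool => x j = b), P0 x = 1 / 2)
    (hm1 : ∀ b : Bool, ∑ x ∈ univ.filter (fun x : Fin k → Bool => x j = b), P1 x = 1 / 2)
    {d : ℕ} (u : U) (v w : V) (hd : ∀ v i, #(fib π u v i) = d)
    {H : (Fin k → (Fin R ⊕ Fin R) → Bool) → (Fin k → (Fin R ⊕ Fin R) → Bool) → ℝ}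
    (hH : ∀ X Y, |H X Y| ≤ 1) (hHj : ∀ X Y z, H (Function.update X j z) Y = H X Y)
    (a : Finset (Fin R ⊕ Fin R) → ℝ) {l : ℝ} (hl : 0 < l) :
    |ET2 π ε P0 P1 d u v w (fun X Y => (∑ β, a β * chi β (X j)) * H X Y)|
      ≤ (l + (∑ β, a β ^ 2 * (1 - ε) ^ #(ptil π u v β)) / l) / 2 := by
  rw [ET2_eq_sum π ε P0 P1 u v w hd]
  have hq : ∀ τ : Fin L → Bool × Option Bool, 0 ≤ ∏ i, outcomeWeight ε (τ i) :=
    fun τ => prod_nonneg fun i _ => outcomeWeight_nonneg hε0 hε1 _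
  calc _ ≤ ∑ τ : Fin L → Bool × Option Bool, (∏ i, outcomeWeight ε (τ i)) *
        ((l + (∑ β ∈ univ.filter (fun β => Disjoint β (resampled π u v τ)), a β ^ 2) / l) / 2) := by
        refine (abs_sum_le_sum_abs _ _).trans (sum_le_sum fun τ _ => ?_)
        rw [abs_mul, abs_of_nonneg (hq τ)]
        refine mul_le_mul_of_nonneg_left ?_ (hq τ)
        have htot := sum_prod_columns_mul_row
          (W := fun c => columnDist P0 P1 (!(τ (blockOf π u w c)).1) (τ (blockOf π u w c)).2
            c.isLeft)
          (fun c b => sum_filter_columnDist hm0 hm1 _ _ _ b) fun _ => 1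
        simp only [mul_one, sum_const, card_univ, nsmul_eq_mul, card_bitStrings] at htot
        rw [div_self (by positivity)] at htot
        refine (abs_sum_le_sum_abs _ _).trans ?_
        rw [← one_mul ((l + _) / 2), ← htot, sum_mul]
        refine sum_le_sum fun Y _ => ?_
        have hnn : 0 ≤ ∏ c, columnDist P0 P1 (!(τ (blockOf π u w c)).1) (τ (blockOf π u w c)).2
            c.isLeft (fun r => Y r c) := prod_nonneg fun c _ => columnDist_nonneg hP0 hP1 _ _ _ _
        rw [abs_mul, abs_of_nonneg hnn]
        refine mul_le_mul_of_nonneg_left ?_ hnn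
        refine abs_sum_columns_le
          (W := fun c => columnDist P0 P1 (τ (blockOf π u v c)).1 (τ (blockOf π u v c)).2 c.isLeft)
          (fun c => columnDist_nonneg hP0 hP1 _ _ _)
          (fun c b => sum_filter_columnDist hm0 hm1 _ _ _ b) (fun c hc x => ?_)
          (fun X => hH X Y) (fun X z => hHj X Y z) a hl
        exact if_pos (mem_filter.mp hc).2
    _ = (l + (∑ β, a β ^ 2 * ∑ τ : Fin L → Bool × Option Bool, (∏ i, outcomeWeight ε (τ i)) *
        (if Disjoint β (resampled π u v τ) then 1 else 0)) / l) / 2 := by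
        have htot : ∑ τ : Fin L → Bool × Option Bool, ∏ i, outcomeWeight ε (τ i) = 1 := by
          rw [← Fintype.prod_sum fun _ t => outcomeWeight ε t]
          simp [sum_outcomeWeight]
        have hswap : ∑ β, a β ^ 2 * ∑ τ : Fin L → Bool × Option Bool,
              (∏ i, outcomeWeight ε (τ i)) * (if Disjoint β (resampled π u v τ) then 1 else 0)
            = ∑ τ : Fin L → Bool × Option Bool, (∏ i, outcomeWeight ε (τ i)) *
              ∑ β ∈ univ.filter (fun β => Disjoint β (resampled π u v τ)), a β ^ 2 := by
          simp only [mul_sum, sum_filter]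
          rw [sum_comm]
          refine sum_congr rfl fun τ _ => sum_congr rfl fun β _ => ?_
          split_ifs <;> ring
        rw [hswap]
        simp only [mul_div_assoc', mul_add, sum_add_distrib, ← sum_div, ← sum_mul, htot, one_mul]
    _ ≤ _ := by
        gcongr with β
        exact sum_outcomeWeight_disjoint_le π hε0 hε1 u v β

lemma blockM_swap {U V : Type} {k L R : ℕ} (π : U → V → Fin R → Fin L)
    (ε : ℝ) (P0 P1 : (Fin k → Bool) → ℝ) (d : ℕ) (u : U) (v w : V) (i : Fin L)
    (X Y : Fin k → (Fin R ⊕ Fin R) → Bool) :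
    blockM π ε P0 P1 d u v w i X Y = blockM π ε P0 P1 d u w v i Y X := by
  simp only [blockM, Fintype.sum_bool, Bool.not_true, Bool.not_false]
  ring

lemma ET2_swap {U V : Type} {k L R : ℕ} (π : U → V → Fin R → Fin L)
    (ε : ℝ) (P0 P1 : (Fin k → Bool) → ℝ) (d : ℕ) (u : U) (v w : V)
    (h : (Fin k → (Fin R ⊕ Fin R) → Bool) → (Fin k → (Fin R ⊕ Fin R) → Bool) → ℝ) :
    ET2 π ε P0 P1 d u v w h = ET2 π ε P0 P1 d u w v (fun X Y => h Y X) := by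
  unfold ET2
  rw [sum_comm]
  refine sum_congr rfl fun Y _ => sum_congr rfl fun X _ => ?_
  simp only [massT2, blockM_swap π ε P0 P1 d u v w]

lemma ET2_sub {U V : Type} {k L R : ℕ} (π : U → V → Fin R → Fin L)
    (ε : ℝ) (P0 P1 : (Fin k → Bool) → ℝ) (d : ℕ) (u : U) (v w : V)
    (g h : (Fin k → (Fin R ⊕ Fin R) → Bool) → (Fin k → (Fin R ⊕ Fin R) → Bool) → ℝ) :
    ET2 π ε P0 P1 d u v w g - ET2 π ε P0 P1 d u v w h
      = ET2 π ε P0 P1 d u v w (fun X Y => g X Y - h X Y) := by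
  simp only [ET2, mul_sub, sum_sub_distrib]

lemma abs_prod_le_one {ι : Type*} (s : Finset ι) {F : ι → ℝ} (hF : ∀ i, |F i| ≤ 1) :
    |∏ i ∈ s, F i| ≤ 1 := by
  rw [abs_prod]
  exact prod_le_one (fun _ _ => abs_nonneg _) fun i _ => hF i

/-- The weighted Fourier mass of `T_{1-γ} f - f` controlling the effect of replacing `f` by
`T_{1-γ} f` in one row of the test. -/
noncomputable def attenuationError {U V : Type} {L R : ℕ} (π : U → V → Fin R → Fin L) (ε γ : ℝ)
    (u : U) (v : V) (f : ((Fin R ⊕ Fin R) → Bool) → ℝ) : ℝ :=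
  ∑ β, (((1 - γ) ^ #β - 1) * fhat f β) ^ 2 * (1 - ε) ^ #(ptil π u v β)

lemma abs_ET2_attenuate_le {U V : Type} {k L R : ℕ} (π : U → V → Fin R → Fin L)
    {ε : ℝ} (hε0 : 0 ≤ ε) (hε1 : ε ≤ 1 / 2) {P0 P1 : (Fin k → Bool) → ℝ}
    (hP0 : ∀ x, 0 ≤ P0 x) (hP1 : ∀ x, 0 ≤ P1 x)
    (hm0 : ∀ (j : Fin k) (b : Bool),
      ∑ x ∈ univ.filter (fun x : Fin k → Bool => x j = b), P0 x = 1 / 2)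
    (hm1 : ∀ (j : Fin k) (b : Bool),
      ∑ x ∈ univ.filter (fun x : Fin k → Bool => x j = b), P1 x = 1 / 2)
    {d : ℕ} (u : U) (v w : V) (hd : ∀ v i, #(fib π u v i) = d)
    {γ : ℝ} (hγ0 : 0 ≤ γ) (hγ1 : γ ≤ 1) {f : ((Fin R ⊕ Fin R) → Bool) → ℝ} (hf : ∀ x, |f x| ≤ 1)
    {ψ : (Fin k → (Fin R ⊕ Fin R) → Bool) → ℝ} (hψ : ∀ Y, |ψ Y| ≤ 1) {l : ℝ} (hl : 0 < l) :
    |ET2 π ε P0 P1 d u v w (fun X Y => (∏ j, f (X j)) * ψ Y)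
        - ET2 π ε P0 P1 d u v w (fun X Y => (∏ j, noiseT γ f (X j)) * ψ Y)|
      ≤ k * ((l + attenuationError π ε γ u v f / l) / 2) := by
  set B := (l + attenuationError π ε γ u v f / l) / 2
  have key : ∀ S : Finset (Fin k),
      |ET2 π ε P0 P1 d u v w (fun X Y => (∏ j, f (X j)) * ψ Y)
        - ET2 π ε P0 P1 d u v w
          (fun X Y => (∏ j, (if j ∈ S then noiseT γ f else f) (X j)) * ψ Y)| ≤ #S * B := by
    intro S
    induction S using Finset.induction_on with
    | empty => simp
    | insert j S hj ih =>
      have hrow : ∀ (i : Fin k) x, |(if i ∈ S then noiseT γ f else f) x| ≤ 1 := by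
        intro i x
        split_ifs
        exacts [abs_noiseT_le_one hγ0 hγ1 hf x, hf x]
      have hstep := abs_ET2_le π hε0 hε1 hP0 hP1 (hm0 j) (hm1 j) u v w hd
        (H := fun X Y => (∏ i ∈ univ.erase j, (if i ∈ S then noiseT γ f else f) (X i)) * ψ Y)
        (fun X Y => by
          rw [abs_mul]
          exact mul_le_one₀ (abs_prod_le_one _ fun i => hrow i _) (abs_nonneg _) (hψ Y))
        (fun X Y z => by
          congr 1
          refine prod_congr rfl fun i hi => ?_
          rw [Function.update_of_ne (ne_of_mem_erase hi)])
        (fun β => ((1 - γ) ^ #β - 1) * fhat f β) hl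
      have hdiff : ET2 π ε P0 P1 d u v w
            (fun X Y => (∏ i, (if i ∈ insert j S then noiseT γ f else f) (X i)) * ψ Y)
          - ET2 π ε P0 P1 d u v w
            (fun X Y => (∏ i, (if i ∈ S then noiseT γ f else f) (X i)) * ψ Y)
          = ET2 π ε P0 P1 d u v w (fun X Y =>
            (∑ β, (((1 - γ) ^ #β - 1) * fhat f β) * chi β (X j)) *
            ((∏ i ∈ univ.erase j, (if i ∈ S then noiseT γ f else f) (X i)) * ψ Y)) := by
        rw [ET2_sub]
        congr 1
        funext X Y
        rw [← noiseT_sub_self, ← mul_prod_erase univ _ (mem_univ j),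
          ← mul_prod_erase univ (fun i => (if i ∈ S then noiseT γ f else f) (X i)) (mem_univ j),
          if_pos (mem_insert_self j S), if_neg hj]
        have hrest : ∏ i ∈ univ.erase j, (if i ∈ insert j S then noiseT γ f else f) (X i)
            = ∏ i ∈ univ.erase j, (if i ∈ S then noiseT γ f else f) (X i) := by
          refine prod_congr rfl fun i hi => ?_
          simp only [mem_insert, ne_of_mem_erase hi, false_or]
        rw [hrest]
        ring
      rw [← hdiff] at hstep
      change _ ≤ B at hstep
      rw [card_insert_of_notMem hj, Nat.cast_add, Nat.cast_one, add_mul, one_mul]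
      rw [abs_sub_comm] at hstep
      exact (abs_sub_le _ _ _).trans (add_le_add ih hstep)
  simpa using key univ

lemma abs_ET2_sub_noiseT_le {U V : Type} {k L R : ℕ} (π : U → V → Fin R → Fin L)
    {ε : ℝ} (hε0 : 0 ≤ ε) (hε1 : ε ≤ 1 / 2) {P0 P1 : (Fin k → Bool) → ℝ}
    (hP0 : ∀ x, 0 ≤ P0 x) (hP1 : ∀ x, 0 ≤ P1 x)
    (hm0 : ∀ (j : Fin k) (b : Bool),
      ∑ x ∈ univ.filter (fun x : Fin k → Bool => x j = b), P0 x = 1 / 2)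
    (hm1 : ∀ (j : Fin k) (b : Bool),
      ∑ x ∈ univ.filter (fun x : Fin k → Bool => x j = b), P1 x = 1 / 2)
    {d : ℕ} (u : U) (v w : V) (hd : ∀ v i, #(fib π u v i) = d)
    {γ : ℝ} (hγ0 : 0 ≤ γ) (hγ1 : γ ≤ 1) {f : V → ((Fin R ⊕ Fin R) → Bool) → ℝ}
    (hf : ∀ v x, |f v x| ≤ 1) {l : ℝ} (hl : 0 < l) :
    |ET2 π ε P0 P1 d u v w (fun X Y => ∏ j : Fin k, f v (X j) * f w (Y j))
        - ET2 π ε P0 P1 d u v w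
          (fun X Y => ∏ j : Fin k, noiseT γ (f v) (X j) * noiseT γ (f w) (Y j))|
      ≤ k * ((l + attenuationError π ε γ u v (f v) / l) / 2
          + (l + attenuationError π ε γ u w (f w) / l) / 2) := by
  have h1 := abs_ET2_attenuate_le π hε0 hε1 hP0 hP1 hm0 hm1 u v w hd hγ0 hγ1 (hf v)
    (ψ := fun Y => ∏ j, f w (Y j)) (fun Y => abs_prod_le_one _ fun j => hf w (Y j)) hl
  have h2 := abs_ET2_attenuate_le π hε0 hε1 hP0 hP1 hm0 hm1 u w v hd hγ0 hγ1 (hf w)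
    (ψ := fun X => ∏ j, noiseT γ (f v) (X j))
    (fun X => abs_prod_le_one _ fun j => abs_noiseT_le_one hγ0 hγ1 (hf v) (X j)) hl
  rw [ET2_swap π ε P0 P1 d u w v, ET2_swap π ε P0 P1 d u w v] at h2
  simp only [mul_comm (∏ j, f w _), mul_comm (∏ j, noiseT γ (f w) _)] at h2
  simp only [prod_mul_distrib]
  rw [mul_add]
  refine (abs_sub_le _ _ _).trans (add_le_add ?_ h2)
  exact h1

lemma sum_sum_nbr {U V : Type} [Fintype U] [Fintype V] (Adj : U → V → Bool) (S : U → V → ℝ) :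
    ∑ u, ∑ v ∈ nbr Adj u, S u v
      = ∑ v, ∑ u ∈ univ.filter (fun u : U => Adj u v = true), S u v :=
  sum_comm' (by simp [nbr])

lemma abs_Euvw_sub_le {U V : Type} [Fintype U] [Fintype V] [Nonempty U] {Adj : U → V → Bool}
    {dU dV : ℕ} (hdU : 0 < dU) (hU : ∀ u : U, #(nbr Adj u) = dU)
    (hV : ∀ v : V, #(univ.filter (fun u : U => Adj u v = true)) = dV)
    {l κ : ℝ} (hl : 0 < l) (hκ : 0 ≤ κ) {S : U → V → ℝ}
    (hS : ∀ v, ∑ u ∈ univ.filter (fun u : U => Adj u v = true), S u v ≤ dV * l ^ 2)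
    {g h : U → V → V → ℝ}
    (hgh : ∀ u v w, |g u v w - h u v w| ≤ κ * ((l + S u v / l) / 2 + (l + S u w / l) / 2)) :
    |Euvw Adj g - Euvw Adj h| ≤ 2 * κ * l := by
  have hcU : (0 : ℝ) < Fintype.card U := by exact_mod_cast Fintype.card_pos
  have hdU' : (0 : ℝ) < dU := by exact_mod_cast hdU
  have hcount : (Fintype.card U : ℝ) * dU = Fintype.card V * dV := by
    have := sum_sum_nbr Adj fun _ _ => 1
    simpa [hU, hV] using this
  have htotal : ∑ u, ∑ v ∈ nbr Adj u, S u v ≤ Fintype.card U * dU * l ^ 2 := by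
    rw [sum_sum_nbr, hcount]
    refine (sum_le_sum fun v _ => hS v).trans (le_of_eq ?_)
    simp
    ring
  have hdiff : Euvw Adj g - Euvw Adj h = Euvw Adj fun u v w => g u v w - h u v w := by
    simp only [Euvw, ← mul_sub, ← sum_sub_distrib]
  rw [hdiff]
  calc _ ≤ Euvw Adj fun u v w => κ * ((l + S u v / l) / 2 + (l + S u w / l) / 2) := by
        unfold Euvw
        rw [abs_mul, abs_of_nonneg (by positivity)]
        refine mul_le_mul_of_nonneg_left ?_ (by positivity)
        refine (abs_sum_le_sum_abs _ _).trans (sum_le_sum fun u _ => ?_)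
        rw [abs_mul, abs_of_nonneg (by positivity)]
        refine mul_le_mul_of_nonneg_left ?_ (by positivity)
        refine (abs_sum_le_sum_abs _ _).trans (sum_le_sum fun v _ => ?_)
        exact (abs_sum_le_sum_abs _ _).trans (sum_le_sum fun w _ => hgh u v w)
    _ = κ / (Fintype.card U * dU) *
          (Fintype.card U * dU * l + (∑ u, ∑ v ∈ nbr Adj u, S u v) / l) := by
        simp only [Euvw, hU, ← mul_sum, sum_add_distrib, ← sum_div, sum_const, card_univ,
          nsmul_eq_mul]
        field_simp
        ring
    _ ≤ κ / (Fintype.card U * dU) *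
          (Fintype.card U * dU * l + (Fintype.card U * dU * l ^ 2) / l) := by gcongr
    _ = 2 * κ * l := by
        field_simp
        ring

lemma one_sub_pow_le_inv {ε : ℝ} (h0 : 0 < ε) (h1 : ε ≤ 1) {m : ℕ} (hm : 0 < m) :
    (1 - ε) ^ m ≤ 1 / ε * (1 / m) := by
  have hm' : (0 : ℝ) < m := by exact_mod_cast hm
  have hb : 1 + (m : ℝ) * ε ≤ (1 + ε) ^ m := one_add_mul_le_pow (by linarith) m
  have hp : (1 - ε) ^ m * (1 + ε) ^ m ≤ 1 := by
    rw [← mul_pow]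
    exact pow_le_one₀ (by nlinarith) (by nlinarith)
  have hnn : 0 ≤ (1 - ε) ^ m := pow_nonneg (by linarith) m
  rw [one_div_mul_one_div, le_div_iff₀ (by positivity)]
  nlinarith [mul_le_mul_of_nonneg_left hb hnn]

lemma one_div_mul_rpow_neg_le {c₀ s ε γ A : ℝ} (hc0 : 0 < c₀) (hc1 : c₀ < 1 / 3) (hε0 : 0 < ε)
    (hε1 : ε ≤ 1 / 2) (hs0 : 0 < s) (hs1 : s < 1)
    (hγ : γ = s ^ ((c₀ + 1) / 4) * ε ^ (1 / c₀)) (hA : s ^ (c₀ / 8) ≤ 2 * A * γ) :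
    1 / ε * A ^ (-(2 * c₀)) ≤ s ^ (c₀ / 4) := by
  set q : ℝ := 2 * s ^ ((2 + c₀) / 8) * ε ^ (1 / c₀) with hq
  have hq0 : 0 < q := by positivity
  have hAq : q⁻¹ ≤ A := by
    have h1 : γ = s ^ (c₀ / 8) * (s ^ ((2 + c₀) / 8) * ε ^ (1 / c₀)) := by
      rw [hγ, ← mul_assoc, ← Real.rpow_add hs0]
      congr 2
      ring
    have h2 : 0 < s ^ (c₀ / 8) := by positivity
    rw [inv_le_iff_one_le_mul₀ hq0, hq]
    rw [h1] at hA
    nlinarith [hA]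
  have hbound : A ^ (-(2 * c₀)) ≤ q ^ (2 * c₀) := by
    calc A ^ (-(2 * c₀)) ≤ (q⁻¹) ^ (-(2 * c₀)) :=
          Real.rpow_le_rpow_of_nonpos (by positivity) hAq (by linarith)
      _ = q ^ (2 * c₀) := by rw [Real.rpow_neg (by positivity), Real.inv_rpow hq0.le, inv_inv]
  have hqpow : q ^ (2 * c₀) = 2 ^ (2 * c₀) * s ^ ((2 + c₀) / 8 * (2 * c₀)) * ε ^ 2 := by
    rw [hq, Real.mul_rpow (by positivity) (by positivity),
      Real.mul_rpow (by positivity) (by positivity), ← Real.rpow_mul hs0.le,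
      ← Real.rpow_mul hε0.le]
    have : 1 / c₀ * (2 * c₀) = (2 : ℕ) := by
      field_simp
      norm_num
    rw [this, Real.rpow_natCast]
  have h2 : (2 : ℝ) ^ (2 * c₀) ≤ 2 := by
    conv_rhs => rw [← Real.rpow_one 2]
    exact Real.rpow_le_rpow_of_exponent_le (by norm_num) (by linarith)
  have hs : s ^ ((2 + c₀) / 8 * (2 * c₀)) ≤ s ^ (c₀ / 4) :=
    Real.rpow_le_rpow_of_exponent_ge hs0 hs1.le (by nlinarith)
  calc 1 / ε * A ^ (-(2 * c₀)) ≤ 1 / ε * q ^ (2 * c₀) := by gcongr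
    _ = 2 ^ (2 * c₀) * ε * s ^ ((2 + c₀) / 8 * (2 * c₀)) := by
        rw [hqpow]
        field_simp
    _ ≤ 2 * (1 / 2) * s ^ (c₀ / 4) := by gcongr
    _ = s ^ (c₀ / 4) := by ring

lemma ptil_eq_image {U V : Type} {L R : ℕ} (π : U → V → Fin R → Fin L) (u : U) (v : V)
    (β : Finset (Fin R ⊕ Fin R)) :
    ptil π u v β = (β.image (Sum.elim id id)).image (π u v) := by
  ext i
  rw [mem_ptil, image_image, mem_image]
  rfl

lemma card_le_two_mul_card_image_elim {α : Type*} [DecidableEq α] (β : Finset (α ⊕ α)) :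
    #β ≤ 2 * #(β.image (Sum.elim id id)) := by
  have h : β ⊆ (β.image (Sum.elim id id)).disjSum (β.image (Sum.elim id id)) := by
    rintro (x | x) hx
    · exact inl_mem_disjSum.mpr (mem_image_of_mem _ hx)
    · exact inr_mem_disjSum.mpr (mem_image_of_mem _ hx)
  calc _ ≤ _ := card_le_card h
    _ = _ := by rw [card_disjSum, two_mul]

lemma sum_attenuationError_le {U V : Type} [Fintype U] {L R : ℕ} {Adj : U → V → Bool}
    {π : U → V → Fin R → Fin L} {dV : ℕ} (hdV : 0 < dV) {v : V}
    (hV : #(univ.filter (fun u : U => Adj u v = true)) = dV)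
    {c₀ s ε γ : ℝ} (hc0 : 0 < c₀) (hc1 : c₀ < 1 / 3)
    (hsmooth : ∀ α : Finset (Fin R),
      (1 / (dV : ℝ)) * ∑ u ∈ univ.filter (fun u : U => Adj u v = true),
        (1 : ℝ) / ((α.image (π u v)).card : ℝ) ≤ (α.card : ℝ) ^ (-(2 * c₀)))
    (hε0 : 0 < ε) (hε1 : ε ≤ 1 / 2) (hs0 : 0 < s) (hs1 : s < 1)
    (hγ : γ = s ^ ((c₀ + 1) / 4) * ε ^ (1 / c₀)) (hγ1 : γ ≤ 1)
    {f : ((Fin R ⊕ Fin R) → Bool) → ℝ} (hf : ∀ x, f x = 1 ∨ f x = -1) :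
    ∑ u ∈ univ.filter (fun u : U => Adj u v = true), attenuationError π ε γ u v f
      ≤ dV * (s ^ (c₀ / 8)) ^ 2 := by
  set N := univ.filter (fun u : U => Adj u v = true)
  have hdV' : (0 : ℝ) < dV := by exact_mod_cast hdV
  have hγ0 : 0 < γ := by rw [hγ]; positivity
  have hsq : (s ^ (c₀ / 8)) ^ 2 = s ^ (c₀ / 4) := by
    rw [← Real.rpow_natCast, ← Real.rpow_mul hs0.le]
    congr 1
    push_cast
    ring
  have hterm : ∀ β : Finset (Fin R ⊕ Fin R),
      ((1 - γ) ^ #β - 1) ^ 2 * ∑ u ∈ N, (1 - ε) ^ #(ptil π u v β) ≤ dV * (s ^ (c₀ / 8)) ^ 2 := by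
    intro β
    have hp0 : 0 ≤ (1 - γ) ^ #β := pow_nonneg (by linarith) _
    have hp1 : (1 - γ) ^ #β ≤ 1 := pow_le_one₀ (by linarith) (by linarith)
    by_cases hsmall : #β * γ ≤ s ^ (c₀ / 8)
    · have hbern : 1 + (#β : ℝ) * (-γ) ≤ (1 + -γ) ^ #β := one_add_mul_le_pow (by linarith) _
      rw [← sub_eq_add_neg] at hbern
      have h1 : ((1 - γ) ^ #β - 1) ^ 2 ≤ (s ^ (c₀ / 8)) ^ 2 := by
        exact sq_le_sq' (by linarith) (by linarith [show 0 < s ^ (c₀ / 8) by positivity])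
      have h2 : ∑ u ∈ N, (1 - ε) ^ #(ptil π u v β) ≤ dV := by
        rw [← hV, ← nsmul_one, ← sum_const]
        exact sum_le_sum fun u _ => pow_le_one₀ (by linarith) (by linarith)
      rw [mul_comm]
      exact mul_le_mul h2 h1 (sq_nonneg _) hdV'.le
    · push Not at hsmall
      set α := β.image (Sum.elim id id)
      have hcard : (#β : ℝ) ≤ 2 * #α := by exact_mod_cast card_le_two_mul_card_image_elim β
      have hαpos : α.Nonempty := by
        rw [nonempty_iff_ne_empty]
        intro hempty
        rw [hempty] at hcard
        have : 0 < s ^ (c₀ / 8) := by positivity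
        simp at hcard
        simp [hcard] at hsmall
        linarith
      have h1 : ((1 - γ) ^ #β - 1) ^ 2 ≤ 1 := by nlinarith
      have h2 : ∑ u ∈ N, (1 - ε) ^ #(ptil π u v β) ≤ dV * s ^ (c₀ / 4) := by
        calc _ ≤ ∑ u ∈ N, 1 / ε * (1 / (#(α.image (π u v)) : ℝ)) := by
              refine sum_le_sum fun u _ => ?_
              rw [ptil_eq_image]
              exact one_sub_pow_le_inv hε0 (by linarith) (hαpos.image _).card_pos
          _ = dV * (1 / ε * ((1 / (dV : ℝ)) * ∑ u ∈ N, 1 / (#(α.image (π u v)) : ℝ))) := by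
              rw [← mul_sum, mul_left_comm, ← mul_assoc (dV : ℝ),
                mul_one_div_cancel hdV'.ne', one_mul]
          _ ≤ dV * (1 / ε * (#α : ℝ) ^ (-(2 * c₀))) := by
              gcongr
              exact hsmooth α
          _ ≤ _ := by
              gcongr
              refine one_div_mul_rpow_neg_le hc0 hc1 hε0 hε1 hs0 hs1 hγ (hsmall.le.trans ?_)
              gcongr
      have hnn : 0 ≤ ∑ u ∈ N, (1 - ε) ^ #(ptil π u v β) :=
        sum_nonneg fun u _ => pow_nonneg (by linarith) _
      rw [hsq]
      exact (mul_le_of_le_one_left hnn h1).trans h2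
  calc _ = ∑ β, fhat f β ^ 2 * (((1 - γ) ^ #β - 1) ^ 2 * ∑ u ∈ N, (1 - ε) ^ #(ptil π u v β)) := by
        simp only [attenuationError, mul_sum]
        rw [sum_comm]
        exact sum_congr rfl fun β _ => sum_congr rfl fun u _ => by ring
    _ ≤ ∑ β, fhat f β ^ 2 * (dV * (s ^ (c₀ / 8)) ^ 2) :=
        sum_le_sum fun β _ => mul_le_mul_of_nonneg_left (hterm β) (sq_nonneg _)
    _ = _ := by rw [← sum_mul, sum_fhat_sq hf, one_mul]

/-- attenuation: there is an absolute constant `C > 0` such that for every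
`c₀`-smooth Label-Cover instance (bi-regular, `R = dL`, `d`-regular fibers), every
`ε ∈ (0, 1/2]`, `s ∈ (0,1)` and `γ = s^{(c₀+1)/4} ε^{1/c₀}`, and every family of `±1`-valued
long-code tables `f_v`, replacing each table by its `T_{1-γ}`-attenuated version changes
`E_{u,v,w} E_{𝒯₂}[Π_j f_v(x_j) f_w(y_j)]` by at most `C·k·s^{c₀/8}`. -/
theorem stmt_11 :
    ∃ C : ℝ, 0 < C ∧
      ∀ (k L R d : ℕ), 2 ≤ k → 0 < d → R = d * L →
      ∀ (U V : Type) [Fintype U] [Fintype V] [Nonempty U] [Nonempty V]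
        (Adj : U → V → Bool) (π : U → V → Fin R → Fin L)
        (dU dV : ℕ), 0 < dU → 0 < dV →
        (∀ u : U, (nbr Adj u).card = dU) →
        (∀ v : V, (univ.filter (fun u : U => Adj u v = true)).card = dV) →
        (∀ (u : U) (v : V) (i : Fin L), (fib π u v i).card = d) →
      ∀ (c₀ : ℝ), 0 < c₀ → c₀ < 1 / 3 →
        (∀ (v : V) (α : Finset (Fin R)),
          (1 / (dV : ℝ)) * ∑ u ∈ univ.filter (fun u : U => Adj u v = true),
              (1 : ℝ) / ((α.image (π u v)).card : ℝ)
            ≤ (α.card : ℝ) ^ (-(2 * c₀))) →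
      ∀ (ε : ℝ), 0 < ε → ε ≤ 1 / 2 →
      ∀ (P0 P1 : (Fin k → Bool) → ℝ),
        (∀ x, 0 ≤ P0 x) → (∀ x, 0 ≤ P1 x) →
        (∑ x, P0 x = 1) → (∑ x, P1 x = 1) →
        (∀ (j : Fin k) (b : Bool),
          ∑ x ∈ univ.filter (fun x : Fin k → Bool => x j = b), P0 x = 1 / 2) →
        (∀ (j : Fin k) (b : Bool),
          ∑ x ∈ univ.filter (fun x : Fin k → Bool => x j = b), P1 x = 1 / 2) →
        (∀ x : Fin k → Bool, P0 x ≠ 0 → Even (univ.filter (fun i => x i = true)).card) →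
        (∀ x : Fin k → Bool, P1 x ≠ 0 → Odd (univ.filter (fun i => x i = true)).card) →
      ∀ (s γ : ℝ), 0 < s → s < 1 → γ = s ^ ((c₀ + 1) / 4) * ε ^ (1 / c₀) →
      ∀ f : V → ((Fin R ⊕ Fin R) → Bool) → ℝ,
        (∀ v x, f v x = 1 ∨ f v x = -1) →
        |Euvw Adj (fun u v w => ET2 π ε P0 P1 d u v w
              (fun X Y => ∏ j : Fin k, f v (X j) * f w (Y j)))
          - Euvw Adj (fun u v w => ET2 π ε P0 P1 d u v w
              (fun X Y => ∏ j : Fin k, noiseT γ (f v) (X j) * noiseT γ (f w) (Y j)))|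
          ≤ C * k * s ^ (c₀ / 8) := by
  refine ⟨2, two_pos, ?_⟩
  intro k L R d _ _ _ U V _ _ _ _ Adj π dU dV hdU hdV hU hV hd c₀ hc0 hc1 hsmooth ε hε0 hε1
    P0 P1 hP0 hP1 _ _ hm0 hm1 _ _ s γ hs0 hs1 hγ f hf
  have hγ0 : 0 ≤ γ := by rw [hγ]; positivity
  have hγ1 : γ ≤ 1 := by
    rw [hγ]
    exact mul_le_one₀ (Real.rpow_le_one hs0.le hs1.le (by linarith)) (by positivity)
      (Real.rpow_le_one hε0.le (by linarith) (by positivity))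
  have hfabs : ∀ v x, |f v x| ≤ 1 := fun v x => by rcases hf v x with h | h <;> simp [h]
  have hl : 0 < s ^ (c₀ / 8) := by positivity
  exact abs_Euvw_sub_le hdU hU hV hl (Nat.cast_nonneg k)
    (S := fun u v => attenuationError π ε γ u v (f v))
    (fun v => sum_attenuationError_le hdV (hV v) hc0 hc1 (hsmooth v) hε0 hε1 hs0 hs1 hγ hγ1 (hf v))
    (fun u v w => abs_ET2_sub_noiseT_le π hε0.le hε1 hP0 hP1 hm0 hm1 u v w (hd u) hγ0 hγ1
      hfabs hl)
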